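/- Let p, q : [0,1) → ℝ be continuous with ∫₀¹|p(x)|dx < ∞ and ∫₀¹|q(x)|dx < ∞, let ξ ∈ [0,1) and η ∈ ℝ. Then there exists n* ∈ ℕ such that for every n ≥ n* the discretized integral equation of order n has exactly one solution: there is a unique tuple of real coefficients c_0,…,c_{2^n−1} such that ȳ_n = Σ_{k=0}^{2^n−1} c_k ω_k satisfies ȳ_n(x) = η + S_{2^n}( ∫_ξ^{·} (S_{2^n}q(t) − S_{2^n}p(t) ȳ_n(t)) dt )(x) for all x ∈ [0,1). -/

import Mathlib

open MeasureTheory Matrix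

/-- The `k`-th binary digit of `x ∈ [0,1)`, using the expansion terminating in zeros
for dyadic rationals. -/
noncomputable def binDigit (k : ℕ) (x : ℝ) : ℕ := ⌊x * 2 ^ (k + 1)⌋.toNat % 2

/-- Rademacher functions `r_k(x) = (-1)^{x_k}`. -/
noncomputable def rademacher (k : ℕ) (x : ℝ) : ℝ := (-1 : ℝ) ^ binDigit k x

/-- Walsh–Paley functions `ω_n(x) = ∏_k r_k(x)^{n_k}`. -/
noncomputable def walsh (n : ℕ) (x : ℝ) : ℝ :=
  ∏ k ∈ Finset.range n, if n.testBit k then rademacher k x else 1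

/-- Walsh–Fourier coefficient `f̂_k = ∫₀¹ f ω_k`. -/
noncomputable def fcoef (f : ℝ → ℝ) (k : ℕ) : ℝ := ∫ x in (0:ℝ)..1, f x * walsh k x

/-- The `2^n`-th partial sum of the Walsh–Fourier series:
`S_{2^n} f (x) = ∑_{k<2^n} f̂_k ω_k(x)`. -/
noncomputable def S2 (n : ℕ) (f : ℝ → ℝ) (x : ℝ) : ℝ :=
  ∑ k ∈ Finset.range (2 ^ n), fcoef f k * walsh k x

open Finset in
lemma walsh_eq_prod {n k : ℕ} (hk : k < 2 ^ n) (x : ℝ) :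
    walsh k x = ∏ l ∈ range n, if k.testBit l then rademacher l x else 1 := by
  have key : ∀ a b : ℕ, k < 2 ^ a → a ≤ b →
      (∏ l ∈ range a, if k.testBit l then rademacher l x else 1) =
        ∏ l ∈ range b, if k.testBit l then rademacher l x else 1 := by
    intro a b ha hab
    refine prod_subset (range_mono hab) fun l _ hl => ?_
    have hl' : a ≤ l := by simpa using hl
    have : k.testBit l = false :=
      Nat.testBit_lt_two_pow (ha.trans_le (Nat.pow_le_pow_right two_pos hl'))
    simp [this]
  rcases le_total k n with h | h
  · exact key k n Nat.lt_two_pow_self h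
  · exact (key n k hk h).symm

lemma binDigit_eq {n l : ℕ} (hl : l < n) (x : ℝ) :
    binDigit l x = (⌊x * 2 ^ n⌋₊.testBit (n - 1 - l)).toNat := by
  have h2 : x * 2 ^ (l + 1) = x * 2 ^ n / ((2 ^ (n - 1 - l) : ℕ) : ℝ) := by
    have : n = (l + 1) + (n - 1 - l) := by omega
    conv_rhs => rw [this, pow_add]
    rw [show l + 1 + (n - 1 - l) - 1 - l = n - 1 - l by omega]
    push_cast
    field_simp
  rw [Nat.toNat_testBit, binDigit, Int.floor_toNat, h2, Nat.floor_div_natCast]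

open Finset in
lemma sum_prod_testBit (n : ℕ) (a : ℕ → ℝ) :
    ∑ k ∈ range (2 ^ n), ∏ l ∈ range n, (if k.testBit l then a l else 1) =
      ∏ l ∈ range n, (1 + a l) := by
  induction n with
  | zero => simp
  | succ n ih =>
    rw [pow_succ, mul_two, sum_range_add, prod_range_succ, ← ih, mul_add, mul_one, sum_mul]
    congr 1
    · refine sum_congr rfl fun k hk => ?_
      rw [prod_range_succ, Nat.testBit_lt_two_pow (mem_range.1 hk)]
      simp
    · refine sum_congr rfl fun k hk => ?_
      rw [prod_range_succ, Nat.testBit_two_pow_add_eq, Nat.testBit_lt_two_pow (mem_range.1 hk)]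
      simp only [Bool.not_false, if_true]
      congr 1
      refine prod_congr rfl fun l hl => ?_
      rw [Nat.testBit_two_pow_add_gt (mem_range.1 hl)]

lemma floor_mul_two_pow_lt (n : ℕ) {x : ℝ} (hx : x ∈ Set.Ico (0 : ℝ) 1) :
    ⌊x * 2 ^ n⌋₊ < 2 ^ n := by
  rw [Nat.floor_lt (by have := hx.1; positivity)]
  push_cast
  have : (0 : ℝ) < 2 ^ n := by positivity
  nlinarith [hx.2]

lemma rademacher_mul_self (l : ℕ) (x : ℝ) : rademacher l x * rademacher l x = 1 := by
  rw [rademacher, ← mul_pow]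
  simp

open Finset in
/-- The Dirichlet kernel of order `2 ^ n` of the Walsh–Paley system. -/
lemma sum_walsh_mul_walsh (n : ℕ) {x t : ℝ} (hx : x ∈ Set.Ico (0 : ℝ) 1)
    (ht : t ∈ Set.Ico (0 : ℝ) 1) :
    ∑ k ∈ range (2 ^ n), walsh k t * walsh k x =
      if ⌊t * 2 ^ n⌋₊ = ⌊x * 2 ^ n⌋₊ then 2 ^ n else 0 := by
  have h1 : ∑ k ∈ range (2 ^ n), walsh k t * walsh k x =
      ∏ l ∈ range n, (1 + rademacher l t * rademacher l x) := by
    rw [← sum_prod_testBit]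
    refine sum_congr rfl fun k hk => ?_
    rw [walsh_eq_prod (mem_range.1 hk), walsh_eq_prod (mem_range.1 hk), ← prod_mul_distrib]
    refine prod_congr rfl fun l _ => ?_
    split_ifs <;> simp
  rw [h1]
  split_ifs with h
  · have : ∀ l ∈ range n, 1 + rademacher l t * rademacher l x = 2 := by
      intro l hl
      have : rademacher l t = rademacher l x := by
        rw [rademacher, rademacher, binDigit_eq (mem_range.1 hl), binDigit_eq (mem_range.1 hl), h]
      rw [this, rademacher_mul_self]
      norm_num
    rw [prod_congr rfl this]
    simp
  · obtain ⟨i, hi⟩ := Nat.exists_testBit_ne_of_ne h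
    have hin : i < n := by
      by_contra! hin
      have hle := Nat.pow_le_pow_right two_pos hin
      rw [Nat.testBit_lt_two_pow ((floor_mul_two_pow_lt n hx).trans_le hle),
        Nat.testBit_lt_two_pow ((floor_mul_two_pow_lt n ht).trans_le hle)] at hi
      exact hi rfl
    refine prod_eq_zero (i := n - 1 - i) (mem_range.2 (by omega)) ?_
    rw [rademacher, rademacher, binDigit_eq (n := n) (by omega), binDigit_eq (n := n) (by omega),
      show n - 1 - (n - 1 - i) = i by omega]
    revert hi
    cases ⌊t * 2 ^ n⌋₊.testBit i <;> cases ⌊x * 2 ^ n⌋₊.testBit i <;> simp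

open Finset in
lemma walsh_congr {n k : ℕ} (hk : k < 2 ^ n) {x t : ℝ} (h : ⌊x * 2 ^ n⌋₊ = ⌊t * 2 ^ n⌋₊) :
    walsh k x = walsh k t := by
  rw [walsh_eq_prod hk, walsh_eq_prod hk]
  refine prod_congr rfl fun l hl => ?_
  rw [rademacher, rademacher, binDigit_eq (mem_range.1 hl), binDigit_eq (mem_range.1 hl), h]

open Finset in
lemma S2_congr (n : ℕ) (f : ℝ → ℝ) {x t : ℝ} (h : ⌊x * 2 ^ n⌋₊ = ⌊t * 2 ^ n⌋₊) :
    S2 n f x = S2 n f t :=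
  sum_congr rfl fun k hk => by rw [walsh_congr (mem_range.1 hk) h]

lemma measurable_walsh (k : ℕ) : Measurable (walsh k) := by
  have hr : ∀ l, Measurable (rademacher l) := fun l =>
    (Measurable.of_discrete (f := fun z : ℤ => (-1 : ℝ) ^ (z.toNat % 2))).comp
      (Int.measurable_floor.comp (measurable_id.mul_const _))
  refine Finset.measurable_prod _ fun l _ => ?_
  split_ifs
  exacts [hr l, measurable_const]

lemma abs_walsh_le_one (k : ℕ) (x : ℝ) : |walsh k x| ≤ 1 := by
  rw [walsh, Finset.abs_prod]
  refine Finset.prod_le_one (fun _ _ => abs_nonneg _) fun l _ => ?_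
  split_ifs <;> simp [rademacher]

lemma IntervalIntegrable.mul_walsh {f : ℝ → ℝ} {a b : ℝ} (hf : IntervalIntegrable f volume a b)
    (k : ℕ) : IntervalIntegrable (fun t => f t * walsh k t) volume a b := by
  refine hf.mono_fun (hf.def'.aestronglyMeasurable.mul
    (measurable_walsh k).aestronglyMeasurable) (.of_forall fun t => ?_)
  simp only [norm_mul, Real.norm_eq_abs]
  exact mul_le_of_le_one_right (abs_nonneg _) (abs_walsh_le_one k t)

lemma intervalIntegrable_S2 (n : ℕ) (f : ℝ → ℝ) (a b : ℝ) :
    IntervalIntegrable (S2 n f) volume a b := by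
  have : S2 n f = ∑ k ∈ Finset.range (2 ^ n), fun x => fcoef f k * walsh k x := by
    ext x
    simp [S2]
  rw [this]
  exact IntervalIntegrable.sum _ fun k _ => intervalIntegrable_const.mul_walsh k

lemma S2_sub (n : ℕ) {f g : ℝ → ℝ} (hf : IntervalIntegrable f volume 0 1)
    (hg : IntervalIntegrable g volume 0 1) (x : ℝ) :
    S2 n (fun s => f s - g s) x = S2 n f x - S2 n g x := by
  have h : ∀ k, fcoef (fun s => f s - g s) k = fcoef f k - fcoef g k := fun k => by
    simp only [fcoef, sub_mul]
    exact intervalIntegral.integral_sub (hf.mul_walsh k) (hg.mul_walsh k)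
  simp only [S2, h, sub_mul, Finset.sum_sub_distrib]

lemma S2_sum {ι : Type*} (u : Finset ι) (n : ℕ) (c : ι → ℝ) {f : ι → ℝ → ℝ}
    (hf : ∀ i, IntervalIntegrable (f i) volume 0 1) (x : ℝ) :
    S2 n (fun s => ∑ i ∈ u, c i * f i s) x = ∑ i ∈ u, c i * S2 n (f i) x := by
  have h : ∀ k, fcoef (fun s => ∑ i ∈ u, c i * f i s) k = ∑ i ∈ u, c i * fcoef (f i) k := by
    intro k
    simp only [fcoef, Finset.sum_mul, mul_assoc]
    rw [intervalIntegral.integral_finsetSum fun i _ => ((hf i).mul_walsh k).const_mul _]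
    simp only [intervalIntegral.integral_const_mul]
  simp only [S2, h, Finset.sum_mul, Finset.mul_sum, mul_assoc]
  exact Finset.sum_comm

/-- On dyadic intervals of length `2⁻ⁿ` the `2 ^ n`-th Walsh partial sum is the average. -/
lemma S2_eq_integral {n j : ℕ} (hj : j < 2 ^ n) {f : ℝ → ℝ}
    (hf : IntervalIntegrable f volume 0 1) :
    S2 n f (j / 2 ^ n) = 2 ^ n * ∫ t in (j / 2 ^ n : ℝ)..((j + 1) / 2 ^ n), f t := by
  have hN : (0 : ℝ) < 2 ^ n := by positivity
  have hj' : (j : ℝ) + 1 ≤ 2 ^ n := by exact_mod_cast hj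
  have hx : (j / 2 ^ n : ℝ) ∈ Set.Ico (0 : ℝ) 1 :=
    ⟨by positivity, by rw [div_lt_one hN]; linarith⟩
  have hfl : ⌊(j / 2 ^ n : ℝ) * 2 ^ n⌋₊ = j := by
    rw [div_mul_cancel₀ _ hN.ne', Nat.floor_natCast]
  have h1 : S2 n f (j / 2 ^ n) =
      ∫ t in (0 : ℝ)..1, f t * ∑ k ∈ Finset.range (2 ^ n), walsh k t * walsh k (j / 2 ^ n) := by
    simp only [S2, fcoef, Finset.mul_sum, ← mul_assoc]
    rw [intervalIntegral.integral_finsetSum fun k _ => (hf.mul_walsh k).mul_const _]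
    simp only [intervalIntegral.integral_mul_const]
  have hsub : Set.Ico (j / 2 ^ n : ℝ) ((j + 1) / 2 ^ n) ⊆ Set.Ico 0 1 :=
    Set.Ico_subset_Ico hx.1 (by rw [div_le_one hN]; exact hj')
  have hle : (j / 2 ^ n : ℝ) ≤ (j + 1) / 2 ^ n := by gcongr; linarith
  rw [h1, intervalIntegral.integral_of_le zero_le_one, intervalIntegral.integral_of_le hle,
    ← integral_Ico_eq_integral_Ioc, ← integral_Ico_eq_integral_Ioc, ← integral_const_mul]
  have h2 : ∀ t ∈ Set.Ico (0 : ℝ) 1,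
      f t * ∑ k ∈ Finset.range (2 ^ n), walsh k t * walsh k (j / 2 ^ n) =
        (Set.Ico (j / 2 ^ n : ℝ) ((j + 1) / 2 ^ n)).indicator (fun t => 2 ^ n * f t) t := by
    intro t ht
    rw [sum_walsh_mul_walsh n hx ht, hfl, Set.indicator_apply]
    have : ⌊t * 2 ^ n⌋₊ = j ↔ t ∈ Set.Ico (j / 2 ^ n : ℝ) ((j + 1) / 2 ^ n) := by
      rw [Nat.floor_eq_iff (mul_nonneg ht.1 hN.le), Set.mem_Ico, div_le_iff₀ hN, lt_div_iff₀ hN]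
    simp only [this]
    split_ifs <;> ring
  rw [setIntegral_congr_fun measurableSet_Ico h2, setIntegral_indicator measurableSet_Ico,
    Set.inter_eq_self_of_subset_right hsub]

lemma floor_node (n j : ℕ) : ⌊(j / 2 ^ n : ℝ) * 2 ^ n⌋₊ = j := by
  rw [div_mul_cancel₀ _ (by positivity), Nat.floor_natCast]

lemma node_mem_Ico {n j : ℕ} (hj : j < 2 ^ n) : (j / 2 ^ n : ℝ) ∈ Set.Ico (0 : ℝ) 1 :=
  ⟨by positivity, by rw [div_lt_one (by positivity)]; exact_mod_cast hj⟩

/-- A Walsh polynomial of order `2 ^ n` vanishing at all nodes `j / 2 ^ n` is zero. -/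
lemma eq_zero_of_sum_walsh_node_eq_zero {n : ℕ} {c : Fin (2 ^ n) → ℝ}
    (h : ∀ j : Fin (2 ^ n), ∑ k, c k * walsh k.1 (j.1 / 2 ^ n) = 0) : c = 0 := by
  let W : Matrix (Fin (2 ^ n)) (Fin (2 ^ n)) ℝ := Matrix.of fun k j => walsh k.1 (j.1 / 2 ^ n)
  have hW : ((2 ^ n : ℝ)⁻¹ • Wᵀ) * W = 1 := by
    ext i j
    rw [Matrix.smul_mul, Matrix.smul_apply, Matrix.mul_apply]
    simp only [W, Matrix.transpose_apply, Matrix.of_apply]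
    rw [Fin.sum_univ_eq_sum_range (fun k => walsh k (i.1 / 2 ^ n) * walsh k (j.1 / 2 ^ n)),
      sum_walsh_mul_walsh n (node_mem_Ico j.2) (node_mem_Ico i.2), floor_node, floor_node,
      Matrix.one_apply]
    simp only [Fin.ext_iff]
    split_ifs <;> simp
  have hc : Wᵀ *ᵥ c = 0 := by
    ext j
    rw [Matrix.mulVec, dotProduct]
    simpa [W, mul_comm] using h j
  calc c = (W * ((2 ^ n : ℝ)⁻¹ • Wᵀ)) *ᵥ c := by rw [mul_eq_one_comm.1 hW, Matrix.one_mulVec]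
    _ = 0 := by
      rw [← Matrix.mulVec_mulVec, Matrix.smul_mulVec, hc, smul_zero, Matrix.mulVec_zero]

lemma primitive_eq_of_const_Ico {g : ℝ → ℝ} (hg : ∀ a b, IntervalIntegrable g volume a b)
    {a b C : ℝ} (hC : ∀ t ∈ Set.Ico a b, g t = C) (ξ : ℝ) {s : ℝ} (hs : s ∈ Set.Icc a b) :
    ∫ t in ξ..s, g t = (∫ t in ξ..a, g t) + (s - a) * C := by
  rw [← intervalIntegral.integral_add_adjacent_intervals (hg ξ a) (hg a s)]
  congr 1
  rw [intervalIntegral.integral_of_le hs.1, ← integral_Ico_eq_integral_Ioc,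
    setIntegral_congr_fun measurableSet_Ico
      (fun t ht => hC t (Set.Ico_subset_Ico_right hs.2 ht)),
    integral_Ico_eq_integral_Ioc, ← intervalIntegral.integral_of_le hs.1]
  simp

lemma integral_primitive_of_const_Ico {g : ℝ → ℝ} (hg : ∀ a b, IntervalIntegrable g volume a b)
    {a b C : ℝ} (hab : a ≤ b) (hC : ∀ t ∈ Set.Ico a b, g t = C) (ξ : ℝ) :
    ∫ s in a..b, ∫ t in ξ..s, g t = (b - a) * (∫ t in ξ..a, g t) + (b - a) ^ 2 / 2 * C := by
  have h : ∀ s ∈ Set.uIcc a b, ∫ t in ξ..s, g t = (∫ t in ξ..a, g t) + (s - a) * C :=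
    fun s hs => primitive_eq_of_const_Ico hg hC ξ (by rwa [Set.uIcc_of_le hab] at hs)
  rw [intervalIntegral.integral_congr h, intervalIntegral.integral_add (by simp)
    (by apply Continuous.intervalIntegrable; fun_prop), intervalIntegral.integral_mul_const,
    intervalIntegral.integral_sub (by simp) (by simp)]
  simp only [intervalIntegral.integral_const, smul_eq_mul, integral_id]
  ring

lemma exists_forall_abs_integral_dyadic_lt_one {p : ℝ → ℝ}
    (hp : IntervalIntegrable p volume 0 1) :
    ∃ n₀ : ℕ, ∀ n ≥ n₀, ∀ j : ℕ, j < 2 ^ n →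
      |∫ t in (j / 2 ^ n : ℝ)..((j + 1) / 2 ^ n), p t| < 1 := by
  have hcont : ContinuousOn (fun s => ∫ t in (0 : ℝ)..s, p t) (Set.uIcc 0 1) :=
    intervalIntegral.continuousOn_primitive_interval' hp (by simp)
  have hunif := isCompact_uIcc.uniformContinuousOn_of_continuous hcont
  obtain ⟨δ, hδ, H⟩ := Metric.uniformContinuousOn_iff.1 hunif 1 one_pos
  obtain ⟨n₀, hn₀⟩ := exists_pow_lt_of_lt_one hδ (show (1 / 2 : ℝ) < 1 by norm_num)
  refine ⟨n₀, fun n hn j hj => ?_⟩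
  have hN : (0 : ℝ) < 2 ^ n := by positivity
  have hj' : (j : ℝ) + 1 ≤ 2 ^ n := by exact_mod_cast hj
  have ha : (j / 2 ^ n : ℝ) ∈ Set.uIcc (0 : ℝ) 1 := by
    rw [Set.uIcc_of_le zero_le_one]
    exact Set.Ico_subset_Icc_self (node_mem_Ico hj)
  have hb : ((j + 1) / 2 ^ n : ℝ) ∈ Set.uIcc (0 : ℝ) 1 := by
    rw [Set.uIcc_of_le zero_le_one]
    exact ⟨by positivity, by rwa [div_le_one hN]⟩
  have hd : dist ((j + 1) / 2 ^ n : ℝ) (j / 2 ^ n) < δ := by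
    rw [Real.dist_eq, ← sub_div, add_sub_cancel_left, abs_of_pos (by positivity), ← _root_.one_div_pow]
    exact (pow_le_pow_of_le_one (by norm_num) (by norm_num) hn).trans_lt hn₀
  have := H _ hb _ ha hd
  rwa [Real.dist_eq, intervalIntegral.integral_interval_sub_left
    (hp.mono_set (Set.uIcc_subset_uIcc_left hb))
    (hp.mono_set (Set.uIcc_subset_uIcc_left ha))] at this

/-- The homogeneous discretized equation has only the trivial solution as soon as `p` has integral
less than one in absolute value over every dyadic interval. -/
lemma sum_walsh_node_eq_zero_of_homogeneous {n : ℕ} {p : ℝ → ℝ}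
    (hp : IntervalIntegrable p volume 0 1)
    (hsmall : ∀ j : ℕ, j < 2 ^ n → |∫ t in (j / 2 ^ n : ℝ)..((j + 1) / 2 ^ n), p t| < 1)
    {ξ : ℝ} (hξ : ξ ∈ Set.Ico (0 : ℝ) 1) {y : ℝ → ℝ}
    (hyint : ∀ a b, IntervalIntegrable (fun t => S2 n p t * y t) volume a b)
    (hyconst : ∀ x t, ⌊x * 2 ^ n⌋₊ = ⌊t * 2 ^ n⌋₊ → y x = y t)
    (hy : ∀ j : ℕ, j < 2 ^ n → y (j / 2 ^ n) +
      S2 n (fun s => ∫ t in ξ..s, S2 n p t * y t) (j / 2 ^ n) = 0) :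
    ∀ j : ℕ, j < 2 ^ n → y (j / 2 ^ n) = 0 := by
  have hN : (0 : ℝ) < 2 ^ n := by positivity
  set F : ℝ → ℝ := fun s => ∫ t in ξ..s, S2 n p t * y t with hF
  set u : ℕ → ℝ := fun j => ∫ t in (j / 2 ^ n : ℝ)..((j + 1) / 2 ^ n), p t with hu
  have hFint : IntervalIntegrable F volume 0 1 :=
    (intervalIntegral.continuous_primitive hyint ξ).intervalIntegrable _ _
  have hconst : ∀ j : ℕ, j < 2 ^ n → ∀ t ∈ Set.Ico (j / 2 ^ n : ℝ) ((j + 1) / 2 ^ n),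
      S2 n p t * y t = 2 ^ n * u j * y (j / 2 ^ n) := by
    intro j hj t ht
    have hfl : ⌊t * 2 ^ n⌋₊ = ⌊(j / 2 ^ n : ℝ) * 2 ^ n⌋₊ := by
      have h0 : 0 ≤ t := (node_mem_Ico hj).1.trans ht.1
      rwa [floor_node, Nat.floor_eq_iff (by positivity), ← div_le_iff₀ hN, ← lt_div_iff₀ hN]
    rw [S2_congr n p hfl, hyconst _ _ hfl, S2_eq_integral hj hp]
  have hle : ∀ j : ℕ, (j / 2 ^ n : ℝ) ≤ (j + 1) / 2 ^ n := fun j => by gcongr; linarith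
  have hlin : ∀ j : ℕ, j < 2 ^ n → ∀ s ∈ Set.Icc (j / 2 ^ n : ℝ) ((j + 1) / 2 ^ n),
      F s = F (j / 2 ^ n) + (s * 2 ^ n - j) * (u j * y (j / 2 ^ n)) := by
    intro j hj s hs
    rw [hF]
    dsimp only
    rw [primitive_eq_of_const_Ico hyint (hconst j hj) ξ hs]
    field_simp
  have hstep : ∀ j : ℕ, j < 2 ^ n →
      F ((j + 1 : ℕ) / 2 ^ n) = F (j / 2 ^ n) + u j * y (j / 2 ^ n) := by
    intro j hj
    push_cast
    rw [hlin j hj _ ⟨hle j, le_rfl⟩, div_mul_cancel₀ _ hN.ne']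
    ring
  have hval : ∀ j : ℕ, j < 2 ^ n → y (j / 2 ^ n) * (1 + u j / 2) = -F (j / 2 ^ n) := by
    intro j hj
    have h := hy j hj
    rw [S2_eq_integral hj hFint, hF,
      integral_primitive_of_const_Ico hyint (hle j) (hconst j hj) ξ] at h
    have h2 : ((j + 1) / 2 ^ n - j / 2 ^ n : ℝ) = 1 / 2 ^ n := by ring
    rw [h2] at h
    field_simp at h
    simp only [hF]
    linarith
  have hpos : ∀ j : ℕ, j < 2 ^ n → -1 < u j ∧ u j < 1 := fun j hj => abs_lt.1 (hsmall j hj)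
  have hyF : ∀ j : ℕ, j < 2 ^ n → F (j / 2 ^ n) = 0 → y (j / 2 ^ n) = 0 := by
    intro j hj h
    have hv := hval j hj
    rw [h, neg_zero] at hv
    exact (mul_eq_zero.1 hv).resolve_right (by linarith [(hpos j hj).1])
  have hup : ∀ j : ℕ, j < 2 ^ n → F (j / 2 ^ n) = 0 → F ((j + 1 : ℕ) / 2 ^ n) = 0 := by
    intro j hj h
    rw [hstep j hj, h, hyF j hj h]
    ring
  have hback : ∀ j : ℕ, j < 2 ^ n → ∀ θ ∈ Set.Icc (0 : ℝ) 1,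
      F (j / 2 ^ n) + θ * (u j * y (j / 2 ^ n)) = 0 → F (j / 2 ^ n) = 0 := by
    intro j hj θ hθ h
    have hv := hval j hj
    have h3 : y (j / 2 ^ n) * (1 + (1 / 2 - θ) * u j) = 0 := by linarith
    have h4 : 1 + (1 / 2 - θ) * u j ≠ 0 := by
      have h5 : |(1 / 2 - θ) * u j| < 1 := by
        rw [abs_mul]
        have h6 : |1 / 2 - θ| ≤ 1 / 2 := abs_le.2 ⟨by linarith [hθ.2], by linarith [hθ.1]⟩
        nlinarith [abs_nonneg (u j), abs_nonneg (1 / 2 - θ), hsmall j hj]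
      linarith [(abs_lt.1 h5).1]
    have h7 := (mul_eq_zero.1 h3).resolve_right h4
    rw [h7] at h
    linarith
  obtain ⟨m, hm⟩ : ∃ m, m = ⌊ξ * 2 ^ n⌋₊ := ⟨_, rfl⟩
  have hmlt : m < 2 ^ n := hm ▸ floor_mul_two_pow_lt n hξ
  have hFm : F (m / 2 ^ n) = 0 := by
    have hfl := (Nat.floor_eq_iff (mul_nonneg hξ.1 hN.le)).1 hm.symm
    refine hback m hmlt (ξ * 2 ^ n - m) ⟨by linarith, by linarith⟩ ?_
    rw [← hlin m hmlt ξ ⟨by rw [div_le_iff₀ hN]; exact hfl.1,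
      by rw [le_div_iff₀ hN]; exact hfl.2.le⟩]
    simp [hF]
  intro j hj
  refine hyF j hj ?_
  rcases le_total m j with h | h
  · induction j, h using Nat.le_induction with
    | base => exact hFm
    | succ k _ ih => exact hup k (by omega) (ih (by omega))
  · induction h using Nat.decreasingInduction with
    | self => exact hFm
    | of_succ k _ ih =>
      refine hback k hj 1 (by simp) ?_
      rw [one_mul, ← hstep k hj]
      exact ih (by omega)

/-- Existence and uniqueness of the solution of the discretized integral equation
for all large `n`. -/
theorem unicity_discretized_solution (p q : ℝ → ℝ)
    (hpc : ContinuousOn p (Set.Ico 0 1)) (hqc : ContinuousOn q (Set.Ico 0 1))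
    (hpi : IntegrableOn p (Set.Ico (0:ℝ) 1)) (hqi : IntegrableOn q (Set.Ico (0:ℝ) 1))
    (ξ : ℝ) (hξ : ξ ∈ Set.Ico (0:ℝ) 1) (η : ℝ) :
    ∃ nstar : ℕ, ∀ n ≥ nstar, ∃! c : Fin (2 ^ n) → ℝ,
      ∀ x ∈ Set.Ico (0:ℝ) 1,
        (∑ k : Fin (2 ^ n), c k * walsh k.1 x) =
          η + S2 n (fun s => ∫ t in ξ..s,
            (S2 n q t - S2 n p t * ∑ k : Fin (2 ^ n), c k * walsh k.1 t)) x := by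
  have hp : IntervalIntegrable p volume 0 1 :=
    (intervalIntegrable_iff_integrableOn_Ico_of_le zero_le_one).2 hpi
  obtain ⟨n₀, hn₀⟩ := exists_forall_abs_integral_dyadic_lt_one hp
  refine ⟨n₀, fun n hn => ?_⟩
  have hterm : ∀ (k : ℕ) (a b : ℝ),
      IntervalIntegrable (fun t => S2 n p t * walsh k t) volume a b :=
    fun k a b => (intervalIntegrable_S2 n p a b).mul_walsh k
  have hexp : ∀ (c : Fin (2 ^ n) → ℝ) (t : ℝ), S2 n p t * ∑ k, c k * walsh k.1 t =
      ∑ k, c k * (S2 n p t * walsh k.1 t) := fun c t => by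
    rw [Finset.mul_sum]
    exact Finset.sum_congr rfl fun k _ => by ring
  have hprod : ∀ (c : Fin (2 ^ n) → ℝ) (a b : ℝ),
      IntervalIntegrable (fun t => S2 n p t * ∑ k, c k * walsh k.1 t) volume a b := by
    intro c a b
    simp only [hexp]
    simpa only [Finset.sum_fn] using
      IntervalIntegrable.sum Finset.univ fun k _ => (hterm k.1 a b).const_mul (c k)
  have hprim : ∀ {g : ℝ → ℝ}, (∀ a b, IntervalIntegrable g volume a b) →
      IntervalIntegrable (fun s => ∫ t in ξ..s, g t) volume 0 1 := fun hg =>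
    (intervalIntegral.continuous_primitive hg ξ).intervalIntegrable _ _
  let A : ℕ → ℝ → ℝ := fun k => S2 n fun s => ∫ t in ξ..s, S2 n p t * walsh k t
  have hA : ∀ (c : Fin (2 ^ n) → ℝ) (x : ℝ),
      S2 n (fun s => ∫ t in ξ..s, S2 n p t * ∑ k, c k * walsh k.1 t) x =
        ∑ k, c k * A k.1 x := by
    intro c x
    rw [← S2_sum Finset.univ n c (fun k : Fin (2 ^ n) => hprim (hterm k.1)) x]
    congr 1
    ext s
    simp only [hexp]
    rw [intervalIntegral.integral_finsetSum fun k _ => (hterm k.1 ξ s).const_mul _]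
    simp only [intervalIntegral.integral_const_mul]
  have hrhs : ∀ (c : Fin (2 ^ n) → ℝ) (x : ℝ),
      S2 n (fun s => ∫ t in ξ..s, (S2 n q t - S2 n p t * ∑ k, c k * walsh k.1 t)) x =
        S2 n (fun s => ∫ t in ξ..s, S2 n q t) x - ∑ k, c k * A k.1 x := by
    intro c x
    rw [← hA, ← S2_sub n (hprim (intervalIntegrable_S2 n q)) (hprim (hprod c))]
    congr 1
    ext s
    exact intervalIntegral.integral_sub (intervalIntegrable_S2 n q ξ s) (hprod c ξ s)
  have hwconst : ∀ (c : Fin (2 ^ n) → ℝ) (x t : ℝ), ⌊x * 2 ^ n⌋₊ = ⌊t * 2 ^ n⌋₊ →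
      ∑ k, c k * walsh k.1 x = ∑ k, c k * walsh k.1 t := fun c x t h =>
    Finset.sum_congr rfl fun k _ => by rw [walsh_congr k.2 h]
  let M : Matrix (Fin (2 ^ n)) (Fin (2 ^ n)) ℝ :=
    Matrix.of fun i k => walsh k.1 (i.1 / 2 ^ n) + A k.1 (i.1 / 2 ^ n)
  let b : Fin (2 ^ n) → ℝ := fun i => η + S2 n (fun s => ∫ t in ξ..s, S2 n q t) (i.1 / 2 ^ n)
  have hM : ∀ c i, (M *ᵥ c) i =
      ∑ k, c k * walsh k.1 (i.1 / 2 ^ n) + ∑ k, c k * A k.1 (i.1 / 2 ^ n) := by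
    intro c i
    rw [← Finset.sum_add_distrib, Matrix.mulVec, dotProduct]
    exact Finset.sum_congr rfl fun k _ => by simp only [M, Matrix.of_apply]; ring
  have hiff : ∀ c : Fin (2 ^ n) → ℝ, (∀ x ∈ Set.Ico (0:ℝ) 1,
        (∑ k : Fin (2 ^ n), c k * walsh k.1 x) =
          η + S2 n (fun s => ∫ t in ξ..s,
            (S2 n q t - S2 n p t * ∑ k : Fin (2 ^ n), c k * walsh k.1 t)) x) ↔
      M *ᵥ c = b := by
    intro c
    constructor
    · intro h
      ext i
      have hi := h _ (node_mem_Ico i.2)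
      rw [hrhs] at hi
      rw [hM]
      simp only [b]
      linarith
    · intro h x hx
      have hfl := (floor_node n ⌊x * 2 ^ n⌋₊).symm
      have hi := congrFun h ⟨_, floor_mul_two_pow_lt n hx⟩
      rw [hM] at hi
      simp only [b] at hi
      rw [hwconst c _ _ hfl, S2_congr n _ hfl, hrhs]
      linarith
  have hinj : Function.Injective M.mulVecLin := by
    refine (injective_iff_map_eq_zero _).2 fun c hc => ?_
    refine eq_zero_of_sum_walsh_node_eq_zero fun j => ?_
    refine sum_walsh_node_eq_zero_of_homogeneous hp (hn₀ n hn) hξ (hprod c) (hwconst c)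
      (fun i hi => ?_) j.1 j.2
    rw [hA, ← hM c ⟨i, hi⟩]
    exact congrFun hc ⟨i, hi⟩
  simp only [hiff]
  exact Function.Bijective.existsUnique
    (f := M.mulVecLin) ⟨hinj, LinearMap.injective_iff_surjective.1 hinj⟩ b
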